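/- Let (n, ⟨·,·⟩) be an M-type algebra over ℂ with J-map J, and suppose there exist three linearly independent vectors z_1, z_2, z_3 ∈ n_{-2} such that each J_{z_i} is invertible and J_{z_i} J_{z_j} = σ_{ij} J_{z_j} J_{z_i} for all i ≠ j, where σ_{ij} ∈ {−1,1} and σ_{12} σ_{13} σ_{23} = −1 (condition (C)). Then for every nonzero x ∈ n_{-1} there is no codimension-one subspace L ⊆ n_{-2} with J_z x = 0 for all z ∈ L; equivalently, n has no corank-one element, so n is rigid by the corank one criterion. -/

import Mathlib

/-- Theorem 3.6 (complexified form): an M-type algebra over ℂ satisfying condition (C)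
has no corank-one element: for every nonzero `x ∈ n₋₁` there is no codimension-one
subspace `L ⊆ n₋₂` with `J_z x = 0` for all `z ∈ L`; hence `n` is rigid by the corank
one criterion. -/
theorem conditionC_rigid
    (N1 N2 : Type*) [AddCommGroup N1] [Module ℂ N1] [FiniteDimensional ℂ N1]
    [AddCommGroup N2] [Module ℂ N2] [FiniteDimensional ℂ N2]
    (br : N1 →ₗ[ℂ] N1 →ₗ[ℂ] N2) (halt : ∀ x : N1, br x x = 0)
    (B1 : LinearMap.BilinForm ℂ N1) (B2 : LinearMap.BilinForm ℂ N2)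
    (hB1symm : ∀ x y, B1 x y = B1 y x) (hB2symm : ∀ z w, B2 z w = B2 w z)
    (hB1 : B1.Nondegenerate) (hB2 : B2.Nondegenerate)
    (J : N2 →ₗ[ℂ] Module.End ℂ N1)
    (hJ : ∀ (z : N2) (x y : N1), B1 (J z x) y = B2 z (br x y))
    (z1 z2 z3 : N2) (hind : LinearIndependent ℂ ![z1, z2, z3])
    (hb1 : Function.Bijective ⇑(J z1)) (hb2 : Function.Bijective ⇑(J z2))
    (hb3 : Function.Bijective ⇑(J z3))
    (σ12 σ13 σ23 : ℂ)
    (hσ12 : σ12 = 1 ∨ σ12 = -1) (hσ13 : σ13 = 1 ∨ σ13 = -1) (hσ23 : σ23 = 1 ∨ σ23 = -1)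
    (hprod : σ12 * σ13 * σ23 = -1)
    (h12 : J z1 * J z2 = σ12 • (J z2 * J z1))
    (h13 : J z1 * J z3 = σ13 • (J z3 * J z1))
    (h23 : J z2 * J z3 = σ23 • (J z3 * J z2)) :
    ∀ x : N1, x ≠ 0 →
      ¬ ∃ L : Submodule ℂ N2, Module.finrank ℂ (N2 ⧸ L) = 1 ∧ ∀ z ∈ L, J z x = 0 := by
  rintro x hx ⟨L, hL, hLx⟩
  have inj0 : ∀ z : N2, Function.Bijective ⇑(J z) → ∀ y : N1, y ≠ 0 → J z y ≠ 0 := by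
    intro z hz y hy h
    exact hy (hz.1 (by rw [h, map_zero]))
  have hz1 : L.mkQ z1 ≠ 0 := by
    intro h
    exact inj0 z1 hb1 x hx (hLx z1 (by simpa using h))
  have key : ∀ z : N2, Function.Bijective ⇑(J z) → ∃ b : ℂ, b ≠ 0 ∧ J z x = b • J z1 x := by
    intro z hz
    obtain ⟨b, hb⟩ := (finrank_eq_one_iff_of_nonzero' _ hz1).1 hL (L.mkQ z)
    have hm : z - b • z1 ∈ L := by
      rw [← Submodule.ker_mkQ L, LinearMap.mem_ker, map_sub, map_smul, hb, sub_self]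
    have h := hLx _ hm
    rw [map_sub, map_smul, LinearMap.sub_apply, LinearMap.smul_apply, sub_eq_zero] at h
    refine ⟨b, ?_, h⟩
    rintro rfl
    exact inj0 z hz x hx (by rw [h, zero_smul])
  obtain ⟨b, hb, h2⟩ := key z2 hb2
  obtain ⟨c, hc, h3⟩ := key z3 hb3
  have e12 := congrArg (fun f : Module.End ℂ N1 => f x) h12
  have e13 := congrArg (fun f : Module.End ℂ N1 => f x) h13
  have e23 := congrArg (fun f : Module.End ℂ N1 => f x) h23
  simp only [Module.End.mul_apply, LinearMap.smul_apply, h2, h3, map_smul] at e12 e13 e23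
  have hw := inj0 z1 hb1 _ (inj0 z1 hb1 x hx)
  have s12 : σ12 * σ12 = 1 := by rcases hσ12 with h | h <;> simp [h]
  have s13 : σ13 * σ13 = 1 := by rcases hσ13 with h | h <;> simp [h]
  have f2 : J z2 (J z1 x) = (σ12 * b) • J z1 (J z1 x) := by
    rw [mul_smul, e12, smul_smul, s12, one_smul]
  have f3 : J z3 (J z1 x) = (σ13 * c) • J z1 (J z1 x) := by
    rw [mul_smul, e13, smul_smul, s13, one_smul]
  rw [f2, f3, smul_smul, smul_smul, smul_smul] at e23
  have e := smul_left_injective ℂ hw e23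
  have hbc : b * c ≠ 0 := mul_ne_zero hb hc
  have e' : σ12 = σ13 * σ23 := by
    apply mul_left_cancel₀ hbc
    linear_combination e
  have : (1 : ℂ) = -1 := by
    rw [← hprod, mul_assoc, ← e', s12]
  norm_num at this
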